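/- Let λ'' be a nonzero real number, λ', λ, μ real numbers and β ∈ (0,3). Let a : ℕ → ℂ be a sequence with a₀ = 0, Σ_{k≥1} ((k−2)(k−1)k)² |a_k|² < ∞ and Σ_{k≥1} |a_k|² < ∞. Define d_m = (λ'·m(m−1) + μ·m^β) a_m + iλ·((m−1)√m · a_{m−1} + m√(m+1) · a_{m+1}) for m ≥ 1, and write g = |λ''| (Σ_{k≥1} ((k−2)(k−1)k)² |a_k|²)^{1/2} and f = (Σ_{k≥1} |a_k|²)^{1/2}. Then (Σ_{m≥1} |d_m|²)^{1/2} ≤ (|μ|·5^{β/3}/|λ''|^{β/3}) g^{β/3} f^{1−β/3} + (|λ|·(1+2√2)√5/|λ''|^{1/2}) g^{1/2} f^{1/2} + (|λ'|·5^{2/3}/|λ''|^{2/3}) g^{2/3} f^{1/3} + (65^{β/6}|μ| + (1+2√2)·65^{1/4}|λ| + 65^{1/3}|λ'|) f. -/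

import Mathlib

/-- The real sequence `x` is square summable with `ℓ²`-norm at most `C`. -/
def SqSummableNormLe (x : ℕ → ℝ) (C : ℝ) : Prop :=
  (Summable fun k => x k ^ 2) ∧ Real.sqrt (∑' k, x k ^ 2) ≤ C

namespace SqSummableNormLe

variable {x y : ℕ → ℝ} {C D : ℝ}

theorem add (hx0 : ∀ k, 0 ≤ x k) (hy0 : ∀ k, 0 ≤ y k) (hx : SqSummableNormLe x C)
    (hy : SqSummableNormLe y D) : SqSummableNormLe (fun k => x k + y k) (C + D) := by
  have h := Real.Lp_add_le_tsum_of_nonneg (p := 2) (by norm_num) hx0 hy0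
    (by simpa only [Real.rpow_two] using hx.1) (by simpa only [Real.rpow_two] using hy.1)
  simp only [Real.rpow_two, ← Real.sqrt_eq_rpow] at h
  exact ⟨h.1, h.2.trans (add_le_add hx.2 hy.2)⟩

theorem const_mul (hx : SqSummableNormLe x C) {c : ℝ} (hc : 0 ≤ c) :
    SqSummableNormLe (fun k => c * x k) (c * C) := by
  refine ⟨by simpa only [mul_pow] using hx.1.mul_left (c ^ 2), ?_⟩
  simp only [mul_pow]
  rw [tsum_mul_left, Real.sqrt_mul (sq_nonneg c), Real.sqrt_sq hc]
  exact mul_le_mul_of_nonneg_left hx.2 hc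

theorem mono (hx : SqSummableNormLe x C) (hy0 : ∀ k, 0 ≤ y k) (hyx : ∀ k, y k ≤ x k) :
    SqSummableNormLe y C := by
  have h : ∀ k, y k ^ 2 ≤ x k ^ 2 := fun k => pow_le_pow_left₀ (hy0 k) (hyx k) 2
  have hs : Summable fun k => y k ^ 2 := hx.1.of_nonneg_of_le (fun k => sq_nonneg _) h
  exact ⟨hs, (Real.sqrt_le_sqrt (hs.tsum_le_tsum h hx.1)).trans hx.2⟩

theorem of_succ (h0 : x 0 = 0) (hx : SqSummableNormLe (fun k => x (k + 1)) C) :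
    SqSummableNormLe x C := by
  have hs : Summable fun k => x k ^ 2 := (summable_nat_add_iff 1).1 hx.1
  refine ⟨hs, ?_⟩
  rw [hs.tsum_eq_zero_add, h0]
  simpa using hx.2

theorem succ (hx : SqSummableNormLe x C) : SqSummableNormLe (fun k => x (k + 1)) C := by
  refine ⟨(summable_nat_add_iff 1).2 hx.1, le_trans (Real.sqrt_le_sqrt ?_) hx.2⟩
  rw [hx.1.tsum_eq_zero_add]
  exact le_add_of_nonneg_left (sq_nonneg _)

end SqSummableNormLe

/-- Log-convexity in the exponent of weighted sums, a form of Hölder's inequality. -/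
theorem summable_rpow_mul_and_tsum_le {w b : ℕ → ℝ} (hw : ∀ k, 0 ≤ w k) (hb : ∀ k, 0 ≤ b k)
    {θ : ℝ} (hθ0 : 0 < θ) (hθ1 : θ < 1) (hwb : Summable fun k => w k * b k) (hbs : Summable b) :
    (Summable fun k => w k ^ θ * b k) ∧
      ∑' k, w k ^ θ * b k ≤ (∑' k, w k * b k) ^ θ * (∑' k, b k) ^ (1 - θ) := by
  have h1θ : 0 < 1 - θ := sub_pos.2 hθ1
  have hpq : (1 / θ).HolderConjugate (1 / (1 - θ)) := by
    rw [Real.holderConjugate_iff]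
    refine ⟨(one_lt_div hθ0).2 hθ1, by simp⟩
  have hwb0 : ∀ k, 0 ≤ w k * b k := fun k => mul_nonneg (hw k) (hb k)
  have ef : ∀ k, ((w k * b k) ^ θ) ^ (1 / θ) = w k * b k := fun k => by
    rw [← Real.rpow_mul (hwb0 k), mul_one_div_cancel hθ0.ne', Real.rpow_one]
  have eg : ∀ k, (b k ^ (1 - θ)) ^ (1 / (1 - θ)) = b k := fun k => by
    rw [← Real.rpow_mul (hb k), mul_one_div_cancel h1θ.ne', Real.rpow_one]
  have efg : ∀ k, (w k * b k) ^ θ * b k ^ (1 - θ) = w k ^ θ * b k := fun k => by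
    rw [Real.mul_rpow (hw k) (hb k), mul_assoc,
      ← Real.rpow_add_of_nonneg (hb k) hθ0.le h1θ.le, add_sub_cancel, Real.rpow_one]
  have h := Real.summable_and_inner_le_Lp_mul_Lq_tsum_of_nonneg hpq
    (f := fun k => (w k * b k) ^ θ) (g := fun k => b k ^ (1 - θ))
    (fun k => Real.rpow_nonneg (hwb0 k) _) (fun k => Real.rpow_nonneg (hb k) _)
    (by simpa only [ef] using hwb) (by simpa only [eg] using hbs)
  simpa only [ef, eg, efg, one_div_one_div] using h

/-- The sixth power of `k + 1` is controlled by the square of the symbol of `A*³A³`. -/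
theorem succ_pow_six_le (k : ℕ) :
    ((k : ℝ) + 1) ^ 6 ≤
      25 * ((((k : ℝ) + 1) - 2) * (((k : ℝ) + 1) - 1) * ((k : ℝ) + 1)) ^ 2 + 65 := by
  rcases k with _ | _ | k
  · norm_num
  · norm_num
  · push_cast
    have hk : (0 : ℝ) ≤ k := k.cast_nonneg
    have h : ((k : ℝ) + 1 + 1 + 1) ^ 3 ≤
        5 * (((k : ℝ) + 1 + 1 + 1 - 2) * ((k : ℝ) + 1 + 1 + 1 - 1) * ((k : ℝ) + 1 + 1 + 1)) := by
      nlinarith [mul_nonneg hk hk, mul_nonneg (mul_nonneg hk hk) hk]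
    have h2 := pow_le_pow_left₀ (by positivity) h 2
    nlinarith [h2]

/-- Interpolation of the powers of the number operator between the identity and `A*³A³`. -/
theorem sqSummableNormLe_rpow_mul {x : ℕ → ℝ} {s : ℝ} (hs : s ∈ Set.Ioo (0 : ℝ) 3)
    (hg : Summable fun k : ℕ =>
      ((((k : ℝ) + 1) - 2) * (((k : ℝ) + 1) - 1) * ((k : ℝ) + 1)) ^ 2 * x k ^ 2)
    (hf : Summable fun k : ℕ => x k ^ 2) :
    SqSummableNormLe (fun k => ((k : ℝ) + 1) ^ s * x k)
      (5 ^ (s / 3) * Real.sqrt (∑' k : ℕ,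
            ((((k : ℝ) + 1) - 2) * (((k : ℝ) + 1) - 1) * ((k : ℝ) + 1)) ^ 2 * x k ^ 2) ^ (s / 3)
          * Real.sqrt (∑' k, x k ^ 2) ^ (1 - s / 3)
        + 65 ^ (s / 6) * Real.sqrt (∑' k, x k ^ 2)) := by
  obtain ⟨hs0, hs3⟩ := hs
  have hdom : Summable fun k : ℕ =>
      25 * (((((k : ℝ) + 1) - 2) * (((k : ℝ) + 1) - 1) * ((k : ℝ) + 1)) ^ 2 * x k ^ 2)
        + 65 * x k ^ 2 := (hg.mul_left 25).add (hf.mul_left 65)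
  have hle : ∀ k : ℕ, ((k : ℝ) + 1) ^ 6 * x k ^ 2 ≤
      25 * (((((k : ℝ) + 1) - 2) * (((k : ℝ) + 1) - 1) * ((k : ℝ) + 1)) ^ 2 * x k ^ 2)
        + 65 * x k ^ 2 := fun k => by
    have := mul_le_mul_of_nonneg_right (succ_pow_six_le k) (sq_nonneg (x k))
    linarith
  have hsix : Summable fun k : ℕ => ((k : ℝ) + 1) ^ 6 * x k ^ 2 :=
    hdom.of_nonneg_of_le (fun k => by positivity) hle
  have hsix_le := hsix.tsum_le_tsum hle hdom
  rw [(hg.mul_left 25).tsum_add (hf.mul_left 65), tsum_mul_left, tsum_mul_left] at hsix_le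
  have hsix0 : 0 ≤ ∑' k : ℕ, ((k : ℝ) + 1) ^ 6 * x k ^ 2 :=
    tsum_nonneg fun k => by positivity
  have hG0 : 0 ≤ ∑' k : ℕ,
      ((((k : ℝ) + 1) - 2) * (((k : ℝ) + 1) - 1) * ((k : ℝ) + 1)) ^ 2 * x k ^ 2 :=
    tsum_nonneg fun k => by positivity
  have hF0 : 0 ≤ ∑' k : ℕ, x k ^ 2 := tsum_nonneg fun k => by positivity
  have e : ∀ k : ℕ, (((k : ℝ) + 1) ^ 6) ^ (s / 3) * x k ^ 2 = (((k : ℝ) + 1) ^ s * x k) ^ 2 :=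
    fun k => by
      have hk : (0 : ℝ) ≤ (k : ℝ) + 1 := by positivity
      rw [mul_pow, ← Real.rpow_natCast_mul hk, ← Real.rpow_mul_natCast hk]
      congr 2
      push_cast
      ring
  obtain ⟨hsum, hhol⟩ := summable_rpow_mul_and_tsum_le
    (w := fun k : ℕ => ((k : ℝ) + 1) ^ 6) (b := fun k => x k ^ 2) (θ := s / 3)
    (fun k => by positivity) (fun k => sq_nonneg _) (by linarith) (by linarith) hsix hf
  simp only [e] at hsum hhol
  refine ⟨hsum, (Real.sqrt_le_sqrt hhol).trans ?_⟩
  generalize (∑' k : ℕ, ((k : ℝ) + 1) ^ 6 * x k ^ 2) = K at *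
  generalize (∑' k : ℕ,
      ((((k : ℝ) + 1) - 2) * (((k : ℝ) + 1) - 1) * ((k : ℝ) + 1)) ^ 2 * x k ^ 2) = G at *
  generalize (∑' k : ℕ, x k ^ 2) = F at *
  have hKs : K ^ (s / 6) ≤ 5 ^ (s / 3) * Real.sqrt G ^ (s / 3) + 65 ^ (s / 6) * F ^ (s / 6) := by
    have h25 : (25 : ℝ) ^ (s / 6) = 5 ^ (s / 3) := by
      rw [show (25 : ℝ) = 5 ^ (2 : ℝ) by norm_num, ← Real.rpow_mul (by norm_num)]
      ring_nf
    calc K ^ (s / 6) ≤ (25 * G + 65 * F) ^ (s / 6) :=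
          Real.rpow_le_rpow hsix0 hsix_le (by linarith)
      _ ≤ (25 * G) ^ (s / 6) + (65 * F) ^ (s / 6) :=
          Real.rpow_add_le_add_rpow (by positivity) (by positivity) (by linarith) (by linarith)
      _ = _ := by
          rw [Real.mul_rpow (by norm_num) hG0, Real.mul_rpow (by norm_num) hF0, h25,
            Real.sqrt_eq_rpow, ← Real.rpow_mul hG0]
          ring_nf
  have hF1 : F ^ (s / 6) * Real.sqrt F ^ (1 - s / 3) = Real.sqrt F := by
    rw [Real.sqrt_eq_rpow, ← Real.rpow_mul hF0,
      ← Real.rpow_add_of_nonneg hF0 (by linarith) (by linarith)]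
    ring_nf
  calc Real.sqrt (K ^ (s / 3) * F ^ (1 - s / 3))
      = K ^ (s / 6) * Real.sqrt F ^ (1 - s / 3) := by
        rw [Real.sqrt_mul (by positivity), Real.sqrt_eq_rpow, Real.sqrt_eq_rpow,
          Real.sqrt_eq_rpow, ← Real.rpow_mul hsix0, ← Real.rpow_mul hF0, ← Real.rpow_mul hF0]
        ring_nf
    _ ≤ (5 ^ (s / 3) * Real.sqrt G ^ (s / 3) + 65 ^ (s / 6) * F ^ (s / 6))
          * Real.sqrt F ^ (1 - s / 3) := by gcongr
    _ = _ := by rw [add_mul, mul_assoc (65 ^ (s / 6)), hF1]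

/-- The coefficient action of `H₁ = A*(A* + A)A` is bounded by `(1 + √2)` times the power `3/2`
of the number operator. -/
theorem sqSummableNormLe_cubic {x : ℕ → ℝ} (hx : ∀ k, 0 ≤ x k) {C : ℝ}
    (h : SqSummableNormLe (fun k => ((k : ℝ) + 1) ^ (3 / 2 : ℝ) * x (k + 1)) C) :
    SqSummableNormLe (fun k : ℕ => k * Real.sqrt (k + 1) * x k
        + (k + 1) * Real.sqrt (k + 2) * x (k + 2)) (Real.sqrt 2 * C + C) := by
  have e : ∀ t : ℝ, 0 ≤ t → t ^ (3 / 2 : ℝ) = t * Real.sqrt t := fun t ht => by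
    rw [Real.sqrt_eq_rpow, ← Real.rpow_one_add' ht (by norm_num)]
    norm_num
  refine SqSummableNormLe.add (fun k => ?_) (fun k => ?_) ?_ ?_
  · have := hx k
    positivity
  · have := hx (k + 2)
    positivity
  · refine SqSummableNormLe.of_succ (by simp) ((h.const_mul (Real.sqrt_nonneg 2)).mono
      (fun k => ?_) fun k => ?_)
    · have := hx (k + 1)
      positivity
    · have hk : (0 : ℝ) ≤ k := k.cast_nonneg
      have hsq : Real.sqrt ((k : ℝ) + 1 + 1) ≤ Real.sqrt 2 * Real.sqrt (k + 1) := by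
        rw [← Real.sqrt_mul zero_le_two]
        exact Real.sqrt_le_sqrt (by linarith)
      rw [e _ (by positivity)]
      push_cast
      calc ((k : ℝ) + 1) * Real.sqrt (k + 1 + 1) * x (k + 1)
          ≤ ((k : ℝ) + 1) * (Real.sqrt 2 * Real.sqrt (k + 1)) * x (k + 1) := by
            have := hx (k + 1)
            gcongr
        _ = _ := by ring
  · refine h.succ.mono (fun k => ?_) fun k => ?_
    · have := hx (k + 2)
      positivity
    · have := hx (k + 2)
      push_cast
      rw [e _ (by positivity), show (k : ℝ) + 1 + 1 = k + 2 by ring]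
      gcongr
      norm_num

/-- Proposition 3.3: the operator `H^β_{λ',λ,μ} = λ'S + iλH₁ + μH₀^β` is
`{β/3, 1/2, 2/3}`-generalized subordinate to `G_{λ''} = λ''·A*³A³`, expressed in
terms of the coefficient sequence `a k = ⟨φ, e k⟩`, where
`d_m = (λ'·m(m-1) + μ·m^β) a_m + iλ((m-1)√m·a_{m-1} + m√(m+1)·a_{m+1})`,
`g = ‖G_{λ''}φ‖ = |λ''|·(Σ_{k≥1} ((k-2)(k-1)k)²|a_k|²)^{1/2}` and `f = ‖φ‖`. -/
theorem coeff_H_beta_subordinate_G (lam'' lam' lam μ β : ℝ) (hlam'' : lam'' ≠ 0)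
    (hβ : β ∈ Set.Ioo (0 : ℝ) 3) (a d : ℕ → ℂ) (ha0 : a 0 = 0)
    (hg : Summable fun k : ℕ =>
      ((((k : ℝ) + 1) - 2) * (((k : ℝ) + 1) - 1) * ((k : ℝ) + 1)) ^ 2 * ‖a (k + 1)‖ ^ 2)
    (hf : Summable fun k : ℕ => ‖a (k + 1)‖ ^ 2)
    (hd : ∀ m : ℕ, 1 ≤ m →
      d m = ((lam' * ((m : ℝ) * ((m : ℝ) - 1)) + μ * (m : ℝ) ^ β : ℝ) : ℂ) * a m
          + Complex.I * (lam : ℂ) *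
              (((((m : ℝ) - 1) * Real.sqrt (m : ℝ) : ℝ) : ℂ) * a (m - 1)
                + (((m : ℝ) * Real.sqrt ((m : ℝ) + 1) : ℝ) : ℂ) * a (m + 1))) :
    (Summable fun m : ℕ => ‖d (m + 1)‖ ^ 2) ∧
      Real.sqrt (∑' m : ℕ, ‖d (m + 1)‖ ^ 2) ≤
        (|μ| * (5 : ℝ) ^ (β / 3) / |lam''| ^ (β / 3)) *
            (|lam''| * Real.sqrt (∑' k : ℕ,
              ((((k : ℝ) + 1) - 2) * (((k : ℝ) + 1) - 1) * ((k : ℝ) + 1)) ^ 2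
                * ‖a (k + 1)‖ ^ 2)) ^ (β / 3) *
            (Real.sqrt (∑' k : ℕ, ‖a (k + 1)‖ ^ 2)) ^ (1 - β / 3)
          + (|lam| * (1 + 2 * Real.sqrt 2) * Real.sqrt 5 / |lam''| ^ ((1 : ℝ) / 2)) *
              (|lam''| * Real.sqrt (∑' k : ℕ,
                ((((k : ℝ) + 1) - 2) * (((k : ℝ) + 1) - 1) * ((k : ℝ) + 1)) ^ 2
                  * ‖a (k + 1)‖ ^ 2)) ^ ((1 : ℝ) / 2) *
              (Real.sqrt (∑' k : ℕ, ‖a (k + 1)‖ ^ 2)) ^ ((1 : ℝ) / 2)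
          + (|lam'| * (5 : ℝ) ^ ((2 : ℝ) / 3) / |lam''| ^ ((2 : ℝ) / 3)) *
              (|lam''| * Real.sqrt (∑' k : ℕ,
                ((((k : ℝ) + 1) - 2) * (((k : ℝ) + 1) - 1) * ((k : ℝ) + 1)) ^ 2
                  * ‖a (k + 1)‖ ^ 2)) ^ ((2 : ℝ) / 3) *
              (Real.sqrt (∑' k : ℕ, ‖a (k + 1)‖ ^ 2)) ^ ((1 : ℝ) / 3)
          + ((65 : ℝ) ^ (β / 6) * |μ| + (1 + 2 * Real.sqrt 2) * (65 : ℝ) ^ ((1 : ℝ) / 4) * |lam|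
                + (65 : ℝ) ^ ((1 : ℝ) / 3) * |lam'|) *
              Real.sqrt (∑' k : ℕ, ‖a (k + 1)‖ ^ 2) := by
  set G : ℝ := Real.sqrt (∑' k : ℕ,
    ((((k : ℝ) + 1) - 2) * (((k : ℝ) + 1) - 1) * ((k : ℝ) + 1)) ^ 2 * ‖a (k + 1)‖ ^ 2) with hG
  set F : ℝ := Real.sqrt (∑' k : ℕ, ‖a (k + 1)‖ ^ 2) with hF
  have hG0 : 0 ≤ G := Real.sqrt_nonneg _
  have hF0 : 0 ≤ F := Real.sqrt_nonneg _
  have hβ' := sqSummableNormLe_rpow_mul hβ hg hf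
  have h2 := sqSummableNormLe_rpow_mul (s := 2) ⟨by norm_num, by norm_num⟩ hg hf
  have h3 := sqSummableNormLe_cubic (x := fun k => ‖a k‖) (fun k => norm_nonneg _)
    (sqSummableNormLe_rpow_mul (s := 3 / 2) ⟨by norm_num, by norm_num⟩ hg hf)
  rw [← hG, ← hF] at hβ' h2 h3
  have hsum := ((hβ'.const_mul (abs_nonneg μ)).add (fun k => by positivity)
    (fun k => by positivity) (h3.const_mul (abs_nonneg lam))).add (fun k => by positivity)
    (fun k => by positivity) (h2.const_mul (abs_nonneg lam'))
  have hbound : ∀ k : ℕ, ‖d (k + 1)‖ ≤ |μ| * (((k : ℝ) + 1) ^ β * ‖a (k + 1)‖)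
      + |lam| * (k * Real.sqrt (k + 1) * ‖a k‖ + (k + 1) * Real.sqrt (k + 2) * ‖a (k + 2)‖)
      + |lam'| * (((k : ℝ) + 1) ^ (2 : ℝ) * ‖a (k + 1)‖) := fun k => by
    have hk : (0 : ℝ) ≤ k := k.cast_nonneg
    have hdiag : |lam' * (((k : ℝ) + 1) * k) + μ * ((k : ℝ) + 1) ^ β| ≤
        |lam'| * ((k : ℝ) + 1) ^ (2 : ℝ) + |μ| * ((k : ℝ) + 1) ^ β := by
      refine (abs_add_le _ _).trans ?_
      rw [abs_mul lam', abs_mul μ, abs_of_nonneg (show 0 ≤ ((k : ℝ) + 1) * k by positivity),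
        abs_of_nonneg (show 0 ≤ ((k : ℝ) + 1) ^ β by positivity), Real.rpow_two]
      gcongr
      nlinarith
    rw [hd (k + 1) (Nat.le_add_left 1 k), Nat.add_sub_cancel]
    push_cast only [Nat.cast_add, Nat.cast_one]
    rw [add_sub_cancel_right, show (k : ℝ) + 1 + 1 = k + 2 by ring]
    refine (norm_add_le _ _).trans ?_
    have hoff := norm_add_le ((((k : ℝ) * Real.sqrt (k + 1) : ℝ) : ℂ) * a k)
      (((((k : ℝ) + 1) * Real.sqrt (k + 2) : ℝ) : ℂ) * a (k + 2))
    rw [norm_mul, norm_mul, Complex.norm_real, Complex.norm_real,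
      Real.norm_of_nonneg (by positivity), Real.norm_of_nonneg (by positivity)] at hoff
    rw [norm_mul, norm_mul, norm_mul, Complex.norm_I, one_mul, Complex.norm_real,
      Complex.norm_real, Real.norm_eq_abs, Real.norm_eq_abs]
    have h1 := mul_le_mul_of_nonneg_right hdiag (norm_nonneg (a (k + 1)))
    have h2 := mul_le_mul_of_nonneg_left hoff (abs_nonneg lam)
    linarith
  obtain ⟨hs, hle⟩ := hsum.mono (fun k => norm_nonneg _) hbound
  refine ⟨hs, hle.trans ?_⟩
  have hl : 0 < |lam''| := abs_pos.2 hlam''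
  have hscale : ∀ c s t : ℝ, c / |lam''| ^ s * (|lam''| * G) ^ s * t = c * G ^ s * t :=
    fun c s t => by
      have := (Real.rpow_pos_of_pos hl s).ne'
      rw [Real.mul_rpow hl.le hG0]
      field_simp
  rw [hscale, hscale, hscale, Real.sqrt_eq_rpow 5]
  norm_num only [show (3 / 2 / 3 : ℝ) = 1 / 2 by norm_num,
    show (3 / 2 / 6 : ℝ) = 1 / 4 by norm_num,
    show (2 / 6 : ℝ) = 1 / 3 by norm_num, show (1 - 1 / 2 : ℝ) = 1 / 2 by norm_num,
    show (1 - 2 / 3 : ℝ) = 1 / 3 by norm_num]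
  have hslack : 0 ≤ |lam| * (Real.sqrt 2 *
      (5 ^ (1 / 2 : ℝ) * G ^ (1 / 2 : ℝ) * F ^ (1 / 2 : ℝ) + 65 ^ (1 / 4 : ℝ) * F)) := by
    positivity
  linarith
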